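/- arXiv:2108.04100 — 2 statements merged into one kernel-verified Lean document; each statement's English description precedes it below -/
import Mathlib

section
/- For any fixed a > 0 and T > 0, the function k ↦ (e^{k²aT} - 1)/(e^{kaT} - 1)² is strictly convex on (0, ∞), and attains its unique global minimum on (0,∞) at k = 1. -/
lemma aux_sinh_le (h : ℝ) (hh : 0 ≤ h) : Real.sinh h ≤ h * Real.cosh h := by
  have hd : ∀ x : ℝ, HasDerivAt (fun x : ℝ => x * Real.cosh x - Real.sinh x)
      (x * Real.sinh x) x := by
    intro x
    have := ((hasDerivAt_id x).mul (Real.hasDerivAt_cosh x)).sub (Real.hasDerivAt_sinh x)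
    refine this.congr_deriv ?_
    simp
  have hm : MonotoneOn (fun x : ℝ => x * Real.cosh x - Real.sinh x) (Set.Ici 0) := by
    apply monotoneOn_of_deriv_nonneg (convex_Ici 0)
    · exact fun x _ => (hd x).continuousAt.continuousWithinAt
    · exact fun x _ => (hd x).differentiableAt.differentiableWithinAt
    · intro x hx
      rw [interior_Ici] at hx
      rw [(hd x).deriv]
      exact mul_nonneg (le_of_lt hx) (Real.sinh_nonneg_iff.2 (le_of_lt hx))
  have := hm (Set.mem_Ici.2 le_rfl) (Set.mem_Ici.2 hh) hh
  simp at this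
  linarith

lemma aux_sinh_sq (w : ℝ) (hw : 0 ≤ w) :
    Real.sinh w ^ 2 - w ^ 2 ≤ w ^ 2 * Real.sinh w ^ 2 / 2 := by
  obtain ⟨h, rfl⟩ : ∃ h, w = 2 * h := ⟨w / 2, by ring⟩
  have hh : 0 ≤ h := by linarith
  have h1 := aux_sinh_le h hh
  have h0 : 0 ≤ Real.sinh h := Real.sinh_nonneg_iff.2 hh
  have h2 : Real.sinh h ^ 2 ≤ h ^ 2 * (1 + Real.sinh h ^ 2) := by
    have := pow_le_pow_left₀ h0 h1 2
    rw [mul_pow, Real.cosh_sq] at this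
    linarith
  have e : Real.sinh (2 * h) ^ 2 = 4 * Real.sinh h ^ 2 * (1 + Real.sinh h ^ 2) := by
    rw [Real.sinh_two_mul, mul_pow, Real.cosh_sq]; ring
  rw [e]
  have h3 := mul_le_mul_of_nonneg_left h2 (sq_nonneg (Real.sinh h))
  nlinarith

/-- Bounds on P = t e^t/(e^t-1), S = t² e^t/(e^t-1)². -/
lemma aux_bounds (t : ℝ) (ht : 0 < t) :
    1 < t * Real.exp t / (Real.exp t - 1) ∧
    0 < t ^ 2 * Real.exp t / (Real.exp t - 1) ^ 2 ∧
    t ^ 2 * Real.exp t / (Real.exp t - 1) ^ 2 ≤ 1 ∧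
    1 - (t * Real.exp t / (Real.exp t - 1) - 1) ^ 2 / 2 ≤
      t ^ 2 * Real.exp t / (Real.exp t - 1) ^ 2 := by
  obtain ⟨w, rfl⟩ : ∃ w, t = 2 * w := ⟨t / 2, by ring⟩
  have hw : 0 < w := by linarith
  have hs : 0 < Real.sinh w := Real.sinh_pos_iff.2 hw
  have hX := Real.exp_pos w
  have e1 : Real.exp (2 * w) = Real.exp w ^ 2 := by rw [← Real.exp_nat_mul]; norm_num
  have e2 : Real.exp (2 * w) - 1 = 2 * Real.exp w * Real.sinh w := by
    rw [e1, Real.sinh_eq, Real.exp_neg]; field_simp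
  have eP : 2 * w * Real.exp (2 * w) / (Real.exp (2 * w) - 1) = w * Real.exp w / Real.sinh w := by
    rw [e2, e1]; field_simp
  have eS : (2 * w) ^ 2 * Real.exp (2 * w) / (Real.exp (2 * w) - 1) ^ 2
      = w ^ 2 / Real.sinh w ^ 2 := by
    rw [e2, e1]; field_simp; try ring
  rw [eP, eS]
  have hP : w ≤ w * Real.exp w / Real.sinh w - 1 := by
    rw [le_sub_iff_add_le, le_div_iff₀ hs, ← Real.cosh_add_sinh]
    nlinarith [aux_sinh_le w hw.le]
  have hS : 1 - w ^ 2 / 2 ≤ w ^ 2 / Real.sinh w ^ 2 := by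
    rw [le_div_iff₀ (by positivity)]
    linarith [aux_sinh_sq w hw.le]
  refine ⟨by linarith, by positivity, ?_, ?_⟩
  · rw [div_le_one (by positivity)]
    exact pow_le_pow_left₀ hw.le (Real.self_le_sinh_iff.2 hw.le) 2
  · have := pow_le_pow_left₀ hw.le hP 2
    linarith

lemma aux_key (p s q r : ℝ) (hp : 1 < p) (hs : s ≤ 1) (hr : 0 < r)
    (hr' : 1 - (q - 1) ^ 2 / 2 ≤ r) :
    0 < 4 * (p - q) ^ 2 + 2 * p - 4 * s + 2 * r := by
  rcases le_or_gt 2 p with h | h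
  · nlinarith [sq_nonneg (p - q)]
  · nlinarith [sq_nonneg (3 * (q - 1) - 4 * (p - 1)), mul_pos (sub_pos.2 hp) (sub_pos.2 h)]

noncomputable def auxF (c k : ℝ) : ℝ :=
  (Real.exp (c * k ^ 2) - 1) / (Real.exp (c * k) - 1) ^ 2

noncomputable def auxPhi (c k : ℝ) : ℝ :=
  2 * c * k * Real.exp (c * k ^ 2) / (Real.exp (c * k ^ 2) - 1)
    - 2 * c * Real.exp (c * k) / (Real.exp (c * k) - 1)

lemma aux_e1 (c k : ℝ) : HasDerivAt (fun k : ℝ => Real.exp (c * k ^ 2))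
    (2 * c * k * Real.exp (c * k ^ 2)) k := by
  refine (((hasDerivAt_pow 2 k).const_mul c).exp).congr_deriv ?_
  simp; ring

lemma aux_e2 (c k : ℝ) : HasDerivAt (fun k : ℝ => Real.exp (c * k))
    (c * Real.exp (c * k)) k := by
  refine (((hasDerivAt_id k).const_mul c).exp).congr_deriv ?_
  simp; ring

lemma aux_pos (t : ℝ) (ht : 0 < t) : 0 < Real.exp t - 1 := by
  have := Real.one_lt_exp_iff.2 ht
  linarith

lemma aux_d1 (c k : ℝ) (hc : 0 < c) (hk : 0 < k) :
    HasDerivAt (auxF c) (auxF c k * auxPhi c k) k := by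
  have hN := aux_pos (c * k ^ 2) (by positivity)
  have hD := aux_pos (c * k) (by positivity)
  refine (((aux_e1 c k).sub_const 1).div (((aux_e2 c k).sub_const 1).pow 2)
    (pow_ne_zero 2 hD.ne')).congr_deriv ?_
  simp only [auxF, auxPhi, Pi.pow_apply]
  generalize Real.exp (c * k ^ 2) = N at *
  generalize Real.exp (c * k) = D at *
  have := hN.ne'
  have := hD.ne'
  field_simp
  try ring

lemma aux_d2 (c k : ℝ) (hc : 0 < c) (hk : 0 < k) :
    ∃ y, 0 < y ∧ HasDerivAt (fun k => auxF c k * auxPhi c k) y k := by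
  have hN := aux_pos (c * k ^ 2) (by positivity)
  have hD := aux_pos (c * k) (by positivity)
  obtain ⟨hp, -, hs, -⟩ := aux_bounds (c * k ^ 2) (by positivity)
  obtain ⟨-, hr, -, hr'⟩ := aux_bounds (c * k) (by positivity)
  have key := aux_key _ _ _ _ hp hs hr hr'
  have hF : 0 < auxF c k := div_pos hN (by positivity)
  have hphi := ((((hasDerivAt_id k).const_mul (2 * c)).mul (aux_e1 c k)).div
    ((aux_e1 c k).sub_const 1) hN.ne').sub
    (((aux_e2 c k).const_mul (2 * c)).div ((aux_e2 c k).sub_const 1) hD.ne')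
  have hd := (aux_d1 c k hc hk).mul hphi
  refine ⟨_, ?_, hd⟩
  have hkk : 0 < auxF c k / k ^ 2 := by positivity
  refine lt_of_lt_of_eq (mul_pos hkk key) ?_
  simp only [auxPhi, Pi.mul_apply, Pi.sub_apply, Pi.div_apply, id]
  generalize auxF c k = F at *
  generalize Real.exp (c * k ^ 2) = N at *
  generalize Real.exp (c * k) = D at *
  have := hN.ne'
  have := hD.ne'
  field_simp
  ring

/-- For fixed `a > 0`, `T > 0`, the function
`k ↦ (e^{k²aT} - 1)/(e^{kaT} - 1)²` is strictly convex on `(0,∞)` and attains its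
unique global minimum on `(0,∞)` at `k = 1`. -/
theorem stmt_14 (a T : ℝ) (ha : 0 < a) (hT : 0 < T) :
    StrictConvexOn ℝ (Set.Ioi 0)
      (fun k : ℝ => (Real.exp (k ^ 2 * a * T) - 1) / (Real.exp (k * a * T) - 1) ^ 2) ∧
    (∀ k : ℝ, 0 < k → k ≠ 1 →
      (Real.exp (1 ^ 2 * a * T) - 1) / (Real.exp (1 * a * T) - 1) ^ 2 <
        (Real.exp (k ^ 2 * a * T) - 1) / (Real.exp (k * a * T) - 1) ^ 2) := by
  have hc : 0 < a * T := mul_pos ha hT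
  have hfun : ∀ k : ℝ, (Real.exp (k ^ 2 * a * T) - 1) / (Real.exp (k * a * T) - 1) ^ 2
      = auxF (a * T) k := by
    intro k
    have e1 : k ^ 2 * a * T = a * T * k ^ 2 := by ring
    have e2 : k * a * T = a * T * k := by ring
    rw [auxF, e1, e2]
  simp only [hfun]
  generalize a * T = c at *
  have hmono : StrictMonoOn (fun k => auxF c k * auxPhi c k) (Set.Ioi 0) := by
    apply strictMonoOn_of_deriv_pos (convex_Ioi 0)
    · intro x hx
      obtain ⟨y, -, hy⟩ := aux_d2 c x hc hx
      exact hy.continuousAt.continuousWithinAt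
    · intro x hx
      rw [interior_Ioi] at hx
      obtain ⟨y, hy0, hy⟩ := aux_d2 c x hc hx
      rw [hy.deriv]
      exact hy0
  have hconv : StrictConvexOn ℝ (Set.Ioi 0) (auxF c) := by
    apply StrictMonoOn.strictConvexOn_of_deriv (convex_Ioi 0)
    · exact fun x hx => (aux_d1 c x hc hx).continuousAt.continuousWithinAt
    · rw [interior_Ioi]
      exact hmono.congr fun x hx => (aux_d1 c x hc hx).deriv.symm
  refine ⟨hconv, fun k hk hk1 => ?_⟩
  have h1 : HasDerivAt (auxF c) 0 1 := by
    refine (aux_d1 c 1 hc one_pos).congr_deriv ?_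
    simp [auxPhi]
  have hone : (Real.exp (1 ^ 2 * a * T) - 1) / (Real.exp (1 * a * T) - 1) ^ 2 = auxF c 1 :=
    hfun 1
  suffices h : auxF c 1 < auxF c k by
    first
    | exact h
    | (rw [hone]; exact h)
  rcases lt_or_gt_of_ne hk1 with h | h
  · have := hconv.slope_lt_of_hasDerivAt hk (Set.mem_Ioi.2 one_pos) h h1
    rw [slope_def_field, div_neg_iff] at this
    rcases this with h' | h' <;> linarith
  · have := hconv.lt_slope_of_hasDerivAt (Set.mem_Ioi.2 one_pos) hk h h1
    rw [slope_def_field, div_pos_iff] at this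
    rcases this with h' | h' <;> linarith
end

section
/- For fixed a > 0, T > 0, c > 0, d ≥ 1, and m := (x₀ - l)² > 0, the function V(k) = cd(e^{2T(k²-k)a} - 1)/(4(k²-k)a) + m(e^{k²aT}-1)/(e^{kaT}-1)² (extended continuously at k² = k) is strictly convex on (0,∞) and its unique minimizer k* lies in the open interval (1/2, 1). -/
open Real

noncomputable def hh (x : ℝ) : ℝ := x * exp x / (exp x - 1)

lemma expm1_pos {x : ℝ} (hx : 0 < x) : 0 < exp x - 1 := by
  have := Real.add_one_lt_exp hx.ne'
  linarith

lemma exp_sub_half (u : ℝ) : exp (2*u) - 1 = 2 * sinh u * exp u := by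
  rw [sinh_eq, two_mul, exp_add, exp_neg]; field_simp

lemma hh_two (u : ℝ) (hu : 0 < u) : hh (2*u) = u + u * cosh u / sinh u := by
  have hs : 0 < sinh u := sinh_pos_iff.2 hu
  have he := exp_pos u
  have h1 : exp u = sinh u + cosh u := by rw [sinh_eq, cosh_eq]; ring
  rw [hh, exp_sub_half, two_mul u, exp_add]
  field_simp
  rw [h1]; ring

lemma sinh_le_mul_cosh {u : ℝ} (hu : 0 ≤ u) : sinh u ≤ u * cosh u := by
  have : MonotoneOn (fun u => u * cosh u - sinh u) (Set.Ici 0) := by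
    apply monotoneOn_of_deriv_nonneg (convex_Ici 0)
    · fun_prop
    · fun_prop
    · intro x hx
      simp at hx
      have : HasDerivAt (fun u => u * cosh u - sinh u) (1 * cosh x + x * sinh x - cosh x) x :=
        ((hasDerivAt_id x).mul (hasDerivAt_cosh x)).sub (hasDerivAt_sinh x)
      rw [this.deriv]
      have := sinh_pos_iff.2 hx
      have := mul_pos hx this
      linarith
  have := this (Set.mem_Ici.2 le_rfl) (Set.mem_Ici.2 hu) hu
  simp at this
  linarith

lemma le_sinh {u : ℝ} (hu : 0 ≤ u) : u ≤ sinh u := self_le_sinh_iff.2 hu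

lemma coth_mono {u v : ℝ} (hu : 0 < u) (huv : u ≤ v) :
    u * cosh u / sinh u ≤ v * cosh v / sinh v := by
  have : MonotoneOn (fun u => u * cosh u / sinh u) (Set.Ioi 0) := by
    have hd : ∀ x ∈ Set.Ioi (0:ℝ), HasDerivAt (fun u => u * cosh u / sinh u)
        (((1 * cosh x + x * sinh x) * sinh x - x * cosh x * cosh x) / sinh x ^ 2) x := by
      intro x hx
      exact ((hasDerivAt_id x).mul (hasDerivAt_cosh x)).div (hasDerivAt_sinh x)
        (sinh_pos_iff.2 hx).ne'
    apply monotoneOn_of_deriv_nonneg (convex_Ioi 0)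
    · exact fun x hx => (hd x hx).continuousAt.continuousWithinAt
    · rw [interior_Ioi]
      exact fun x hx => (hd x hx).differentiableAt.differentiableWithinAt
    · rw [interior_Ioi]
      intro x hx
      rw [(hd x hx).deriv]
      apply div_nonneg _ (sq_nonneg _)
      have h1 := le_sinh (le_of_lt hx)
      have h2 := one_le_cosh x
      have h3 := cosh_sq x
      have h4 : 0 < x := hx
      nlinarith
  exact this hu (lt_of_lt_of_le hu huv) huv

lemma hh_sq (x y : ℝ) (hx : 0 < x) (hy : 0 < y) : (y - x)^2/4 ≤ (hh y - hh x)^2 := by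
  wlog h : x ≤ y with H
  · have := H y x hy hx (le_of_not_ge h); linarith [this, sq_nonneg (x-y)]
  have h1 := hh_two (x/2) (by linarith)
  have h2 := hh_two (y/2) (by linarith)
  have h3 := coth_mono (u := x/2) (v := y/2) (by linarith) (by linarith)
  rw [mul_div_cancel₀ _ two_ne_zero] at h1 h2
  nlinarith

lemma hh_ge (x : ℝ) (hx : 0 < x) : 1 + x/2 ≤ hh x := by
  have h1 := hh_two (x/2) (by linarith)
  rw [mul_div_cancel₀ _ two_ne_zero] at h1
  have h2 : 1 ≤ (x/2) * cosh (x/2) / sinh (x/2) := by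
    rw [le_div_iff₀ (sinh_pos_iff.2 (by linarith)), one_mul]
    exact sinh_le_mul_cosh (by linarith)
  linarith

/-- `h (h - x) = s`. -/
lemma hh_s (x : ℝ) (hx : 0 < x) : hh x * (hh x - x) = ((x/2) / sinh (x/2))^2 := by
  have h1 := hh_two (x/2) (by linarith)
  rw [mul_div_cancel₀ _ two_ne_zero] at h1
  have hs : 0 < sinh (x/2) := sinh_pos_iff.2 (by linarith)
  have h3 := cosh_sq (x/2)
  rw [h1]
  field_simp
  ring_nf
  rw [mul_comm x (1/2)] at *
  have h4 : cosh (1/2*x)^2 = sinh (1/2*x)^2+1 := cosh_sq _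
  ring_nf at h4 ⊢
  rw [h4]; ring

lemma s_le (x : ℝ) (hx : 0 < x) : hh x * (hh x - x) ≤ 1 := by
  rw [hh_s x hx]
  have hs : 0 < sinh (x/2) := sinh_pos_iff.2 (by linarith)
  apply pow_le_one₀ (by positivity)
  rw [div_le_one hs]
  exact le_sinh (by linarith)

lemma s_ge (x : ℝ) (hx : 0 < x) : 1 - x^2/8 ≤ hh x * (hh x - x) := by
  rw [hh_s x hx]
  obtain ⟨v, rfl⟩ : ∃ v, x = 4*v := ⟨x/4, by ring⟩
  have hv : 0 < v := by linarith
  have e : 4*v/2 = 2*v := by ring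
  rw [e, sinh_two_mul]
  have hs : 0 < sinh v := sinh_pos_iff.2 hv
  have hc := cosh_pos v
  have h1 : 1 / cosh v ^2 ≤ 2*v/(2 * sinh v * cosh v) := by
    rw [div_le_div_iff₀ (by positivity) (by positivity)]
    have := sinh_le_mul_cosh hv.le
    nlinarith
  have h2 : (1 / cosh v ^2)^2 ≤ (2*v/(2 * sinh v * cosh v))^2 := by gcongr
  refine le_trans ?_ h2
  have h3 : cosh v ^ 4 ≤ exp (2*v^2) := by
    calc cosh v ^ 4 ≤ (exp (v^2/2))^4 := by gcongr; exact cosh_le_exp_half_sq v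
      _ = exp (2*v^2) := by rw [← exp_nat_mul]; congr 1; push_cast; ring
  have h4 : exp (-(2*v^2)) ≤ (1 / cosh v ^2)^2 := by
    rw [exp_neg, div_pow, one_pow, ← pow_mul, one_div]
    exact inv_anti₀ (by positivity) h3
  have h5 := add_one_le_exp (-(2*v^2))
  linarith

lemma key (x y : ℝ) (hx : 0 < x) (hy : 0 < y) :
    0 < hh x * (1 + 2*x - 4 * hh y) + 3 * hh y^2 - y * hh y := by
  have hE : hh x * (1 + 2*x - 4 * hh y) + 3 * hh y^2 - y * hh y
    = 2*(hh y - hh x)^2 + hh y * (hh y - y) + hh x - 2 * (hh x * (hh x - x)) := by ring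
  rw [hE]
  have a1 := hh_sq x y hx hy
  have a2 := hh_ge x hx
  rcases lt_or_ge x 2 with h | h
  · have a3 := s_le x hx
    have a4 := s_ge y hy
    nlinarith [sq_nonneg (3*(y-x) - x), mul_pos hx (sub_pos.2 h)]
  · have a5 : 0 < hh y * (hh y - y) := by
      rw [hh_s y hy]
      have hs : 0 < sinh (y/2) := sinh_pos_iff.2 (by linarith)
      positivity
    have a6 : hh x - x ≤ 1/2 := by
      have e1 := quadratic_le_exp_of_nonneg hx.le
      have e0 := expm1_pos hx
      have : hh x - x = x / (exp x - 1) := by rw [hh]; field_simp; ring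
      rw [this, div_le_div_iff₀ e0 (by norm_num)]
      nlinarith
    nlinarith [sq_nonneg (hh y - hh x)]

lemma bracket_pos (b k : ℝ) (hb : 0 < b) (hk : 0 < k) :
    0 < 2*b*(exp (k^2*b)/(exp (k^2*b)-1)) + 4*k^2*b^2*(exp (k^2*b)/(exp (k^2*b)-1))
      + 6*b^2*(exp (k*b)/(exp (k*b)-1))^2 - 2*b^2*(exp (k*b)/(exp (k*b)-1))
      - 8*k*b^2*(exp (k^2*b)/(exp (k^2*b)-1))*(exp (k*b)/(exp (k*b)-1)) := by
  have h := key (k^2*b) (k*b) (by positivity) (by positivity)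
  simp only [hh, mul_div_assoc] at h
  set A := exp (k^2*b)/(exp (k^2*b)-1)
  set B := exp (k*b)/(exp (k*b)-1)
  have hk2 : 0 < k^2 := by positivity
  refine pos_of_mul_pos_right (a := k^2) ?_ hk2.le
  linarith

noncomputable def G (b k : ℝ) : ℝ := (exp (k^2*b) - 1) / (exp (k*b) - 1)^2
noncomputable def P (b k : ℝ) : ℝ :=
  2*k*b*(exp (k^2*b)/(exp (k^2*b)-1)) - 2*b*(exp (k*b)/(exp (k*b)-1))

lemma hasDeriv_G (b k : ℝ) (hb : 0 < b) (hk : 0 < k) :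
    HasDerivAt (G b) (G b k * P b k) k := by
  have h1 := expm1_pos (show 0 < k^2*b by positivity)
  have h2 := expm1_pos (show 0 < k*b by positivity)
  have d1 : HasDerivAt (fun k => exp (k^2*b) - 1) (exp (k^2*b) * (2*k*b)) k := by
    have := (((hasDerivAt_pow 2 k).mul_const b).exp).sub_const 1
    simpa using this
  have d2 : HasDerivAt (fun k => exp (k*b) - 1) (exp (k*b) * b) k := by
    have := (((hasDerivAt_id k).mul_const b).exp).sub_const 1
    simpa using this
  have := d1.div (d2.pow 2) (pow_ne_zero 2 h2.ne')
  refine this.congr_deriv ?_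
  simp only [G, P, Pi.pow_apply]
  field_simp
  norm_num
  ring

lemma hasDeriv_P (b k : ℝ) (hb : 0 < b) (hk : 0 < k) :
    HasDerivAt (P b) (2*b*(exp (k^2*b)/(exp (k^2*b)-1)) - 4*k^2*b^2*(exp (k^2*b)/(exp (k^2*b)-1)^2)
      + 2*b^2 * (exp (k*b)/(exp (k*b)-1)^2)) k := by
  have h1 := expm1_pos (show 0 < k^2*b by positivity)
  have h2 := expm1_pos (show 0 < k*b by positivity)
  have d1 : HasDerivAt (fun k => exp (k^2*b)) (exp (k^2*b) * (2*k*b)) k := by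
    have := (((hasDerivAt_pow 2 k).mul_const b).exp)
    simpa using this
  have d2 : HasDerivAt (fun k => exp (k*b)) (exp (k*b) * b) k := by
    have := (((hasDerivAt_id k).mul_const b).exp)
    simpa using this
  have d3 : HasDerivAt (fun k => 2*k*b) (2*b) k := by
    have := ((hasDerivAt_id k).const_mul 2).mul_const b
    simpa using this
  have := (d3.mul (d1.div (d1.sub_const 1) h1.ne')).sub
    ((d2.div (d2.sub_const 1) h2.ne').const_mul (2*b))
  refine this.congr_deriv ?_
  simp only [Pi.div_apply]
  field_simp
  ring

lemma G_pos (b k : ℝ) (hb : 0 < b) (hk : 0 < k) : 0 < G b k := by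
  have h1 := expm1_pos (show 0 < k^2*b by positivity)
  have h2 := expm1_pos (show 0 < k*b by positivity)
  unfold G; positivity

lemma GP_mono (b : ℝ) (hb : 0 < b) : StrictMonoOn (fun k => G b k * P b k) (Set.Ioi 0) := by
  have hd := fun k (hk : k ∈ Set.Ioi (0:ℝ)) => (hasDeriv_G b k hb hk).mul (hasDeriv_P b k hb hk)
  apply strictMonoOn_of_deriv_pos (convex_Ioi 0)
  · exact fun x hx => (hd x hx).continuousAt.continuousWithinAt
  · rw [interior_Ioi]
    intro k hk
    have := (hd k hk).deriv
    change 0 < deriv (G b * P b) k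
    rw [this]
    clear this
    have hk' : 0 < k := hk
    have h1 := expm1_pos (show 0 < k^2*b by positivity)
    have h2 := expm1_pos (show 0 < k*b by positivity)
    have := mul_pos (G_pos b k hb hk) (bracket_pos b k hb hk)
    refine this.trans_eq ?_
    rw [mul_assoc (G b k), ← mul_add]
    congr 1
    have q : ∀ e : ℝ, 0 < e - 1 → e/(e-1)^2 = (e/(e-1))^2 - e/(e-1) := by
      intro e he
      field_simp
      ring
    simp only [P]
    rw [q _ h1, q _ h2]
    ring

lemma G_convex (b : ℝ) (hb : 0 < b) : StrictConvexOn ℝ (Set.Ioi 0) (G b) := by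
  apply StrictMonoOn.strictConvexOn_of_deriv (convex_Ioi 0)
  · exact fun x hx => (hasDeriv_G b x hb hx).continuousAt.continuousWithinAt
  · rw [interior_Ioi]
    exact (GP_mono b hb).congr fun x hx => (hasDeriv_G b x hb hx).deriv.symm

noncomputable def phi (y : ℝ) : ℝ := ∫ s in (0:ℝ)..1, exp (y*s)

lemma phi_int (y : ℝ) : IntervalIntegrable (fun s => exp (y*s)) MeasureTheory.volume 0 1 :=
  (by fun_prop : Continuous fun s => exp (y*s)).intervalIntegrable _ _

lemma phi_zero : phi 0 = 1 := by simp [phi]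
lemma phi_eq (y : ℝ) (hy : y ≠ 0) : phi y = (exp y - 1)/y := by
  rw [phi, intervalIntegral.integral_comp_mul_left (fun s => exp s) hy]
  simp
  field_simp

lemma phi_mono : Monotone phi := by
  intro x y h
  apply intervalIntegral.integral_mono_on zero_le_one (phi_int x) (phi_int y)
  intro s hs
  have := hs.1
  gcongr

lemma phi_convex : ConvexOn ℝ Set.univ phi := by
  refine ⟨convex_univ, ?_⟩
  intro x _ y _ p q hp hq hpq
  simp only [phi, smul_eq_mul]
  rw [← intervalIntegral.integral_const_mul, ← intervalIntegral.integral_const_mul,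
    ← intervalIntegral.integral_add ((phi_int x).const_mul p) ((phi_int y).const_mul q)]
  apply intervalIntegral.integral_mono_on zero_le_one (phi_int _)
    (((phi_int x).const_mul p).add ((phi_int y).const_mul q))
  intro s hs
  have := convexOn_exp.2 (Set.mem_univ (x*s)) (Set.mem_univ (y*s)) hp hq hpq
  simp only [smul_eq_mul] at this
  have e : (p * x + q * y) * s = p * (x * s) + q * (y * s) := by ring
  rw [e]; exact this

lemma F_convex (p : ℝ) (hp : 0 < p) : ConvexOn ℝ Set.univ (fun k => phi (p*(k^2-k))) := by
  refine ⟨convex_univ, ?_⟩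
  intro x _ y _ α β hα hβ h
  refine le_trans (phi_mono ?_) (phi_convex.2 (Set.mem_univ _) (Set.mem_univ _) hα hβ h)
  simp only [smul_eq_mul]
  obtain rfl : β = 1 - α := by linarith
  have : 0 ≤ p * (α * (1-α) * (x-y)^2) := by positivity
  nlinarith

lemma F_deriv (p : ℝ) (hp : 0 < p) : HasDerivAt (fun k => phi (p*(k^2-k))) 0 (1/2) := by
  have hphi : DifferentiableAt ℝ phi (p*((1/2)^2-1/2)) := by
    have h0 : p*((1/2)^2-1/2) ≠ 0 := by nlinarith
    have : DifferentiableAt ℝ (fun y => (exp y - 1)/y) (p*((1/2)^2-1/2)) := by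
      fun_prop (disch := exact h0)
    refine this.congr_of_eventuallyEq ?_
    filter_upwards [isOpen_ne.mem_nhds h0] with y hy using phi_eq y hy
  have hd : DifferentiableAt ℝ (fun k => phi (p*(k^2-k))) (1/2) :=
    DifferentiableAt.comp (f := fun k : ℝ => p*(k^2-k)) (1/2) hphi (by fun_prop)
  have hm : IsLocalMin (fun k => phi (p*(k^2-k))) (1/2) := by
    refine Filter.Eventually.of_forall fun k => phi_mono ?_
    nlinarith [mul_nonneg hp.le (sq_nonneg (k-1/2))]
  have := hm.hasDerivAt_eq_zero hd.hasDerivAt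
  rw [← this]; exact hd.hasDerivAt

lemma F_slope (p : ℝ) (hp : 0 < p) : phi (p*((1/2)^2-1/2)) < phi (p*(1^2-1)) := by
  have h0 : p*((1/2)^2-1/2) < 0 := by nlinarith
  rw [phi_eq _ h0.ne]
  norm_num [phi_zero]
  rw [div_lt_iff_of_neg (by linarith)]
  have := add_one_lt_exp (x := -(p*(1/4))) (by linarith)
  linarith

/-- A function with negative derivative decreases to the right. -/
lemma exists_lt_right {f : ℝ → ℝ} {x f' : ℝ} (h : HasDerivAt f f' x) (hf : f' < 0) (z : ℝ)
    (hz : x < z) : ∃ y ∈ Set.Ioo x z, f y < f x := by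
  have h1 := (hasDerivAt_iff_tendsto_slope.1 h).mono_left
    (nhdsWithin_mono x (s := Set.Ioi x) (fun y hy => ne_of_gt hy))
  have h2 := h1.eventually (gt_mem_nhds hf)
  obtain ⟨y, hy, hy'⟩ := (h2.and (Ioo_mem_nhdsGT hz)).exists
  refine ⟨y, hy', ?_⟩
  rw [slope_def_field, div_lt_iff₀ (sub_pos.2 hy'.1)] at hy
  linarith

lemma exists_left {f : ℝ → ℝ} {x f' e : ℝ} (h : HasDerivAt f f' x) (hf : -e < f') (z : ℝ)
    (hz : z < x) : ∃ y ∈ Set.Ioo z x, f y - f x < e * (x - y) := by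
  have h1 := (hasDerivAt_iff_tendsto_slope.1 h).mono_left
    (nhdsWithin_mono x (s := Set.Iio x) (fun y hy => ne_of_lt hy))
  have h2 := h1.eventually (lt_mem_nhds hf)
  obtain ⟨y, hy, hy'⟩ := (h2.and (Ioo_mem_nhdsLT hz)).exists
  refine ⟨y, hy', ?_⟩
  rw [slope_def_field, lt_div_iff_of_neg (sub_neg.2 hy'.2)] at hy
  linarith

theorem main (p b K m : ℝ) (hp : 0 < p) (hb : 0 < b) (hK : 0 < K) (hm : 0 < m) (V : ℝ → ℝ)
    (hV : V = fun k => K * phi (p*(k^2-k)) + m * G b k) :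
    StrictConvexOn ℝ (Set.Ioi 0) V ∧
    ∃ kstar : ℝ, kstar ∈ Set.Ioo (1 / 2 : ℝ) 1 ∧
      ∀ k : ℝ, 0 < k → k ≠ kstar → V kstar < V k := by
  have hF : ConvexOn ℝ (Set.Ioi 0) (fun k => K * phi (p*(k^2-k))) :=
    ((F_convex p hp).subset (Set.subset_univ _) (convex_Ioi 0)).smul hK.le
  have hG : StrictConvexOn ℝ (Set.Ioi 0) (fun k => m * G b k) := by
    refine ⟨convex_Ioi 0, ?_⟩
    intro x hx y hy hxy α β hα hβ h
    have := mul_lt_mul_of_pos_left ((G_convex b hb).2 hx hy hxy hα hβ h) hm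
    simp only [smul_eq_mul] at this ⊢
    linarith
  have hconv : StrictConvexOn ℝ (Set.Ioi 0) V := by
    rw [hV]; exact hF.add_strictConvexOn hG
  refine ⟨hconv, ?_⟩
  have hP1 : G b 1 * P b 1 = 0 := by simp [P]
  have hPh : G b (1/2) * P b (1/2) < 0 := by
    rw [← hP1]
    exact GP_mono b hb (Set.mem_Ioi.2 (by norm_num)) (Set.mem_Ioi.2 (by norm_num)) (by norm_num)
  have dh : HasDerivAt V (K * 0 + m * (G b (1/2) * P b (1/2))) (1/2) := by
    rw [hV]
    exact ((F_deriv p hp).const_mul K).add ((hasDeriv_G b (1/2) hb (by norm_num)).const_mul m)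
  obtain ⟨y1, hy1, hy1'⟩ := exists_lt_right dh (by nlinarith) 1 (by norm_num)
  have hsl := F_slope p hp
  have dG := (hasDeriv_G b 1 hb one_pos).const_mul m
  rw [hP1, mul_zero] at dG
  obtain ⟨y2, hy2, hy2'⟩ := exists_left
    (e := 2 * K * (phi (p*(1^2-1)) - phi (p*((1/2)^2-1/2)))) dG
    (by have := mul_pos hK (sub_pos.2 hsl); linarith) (1/2) (by norm_num)
  have hy2V : V y2 < V 1 := by
    have h := (F_convex p hp).2 (Set.mem_univ (1/2)) (Set.mem_univ 1)
      (show 0 ≤ 2*(1-y2) by linarith [hy2.2]) (show 0 ≤ 2*y2-1 by linarith [hy2.1]) (by ring)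
    simp only [smul_eq_mul] at h
    have e : 2 * (1 - y2) * (1 / 2) + (2 * y2 - 1) * 1 = y2 := by ring
    rw [e] at h
    have := mul_le_mul_of_nonneg_left h hK.le
    rw [hV]
    simp only
    clear h hsl hV
    generalize phi (p*(1^2-1)) = f1 at *
    generalize phi (p*((1/2)^2-1/2)) = f2 at *
    generalize phi (p*(y2^2-y2)) = f3 at *
    generalize m * G b y2 = g1 at *
    generalize m * G b 1 = g2 at *
    nlinarith
  have hsub : Set.Icc (1/2:ℝ) 1 ⊆ Set.Ioi 0 := fun x hx => lt_of_lt_of_le (by norm_num) hx.1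
  have hcont : ContinuousOn V (Set.Icc (1/2) 1) :=
    (hconv.convexOn.continuousOn isOpen_Ioi).mono hsub
  obtain ⟨ks, hks, hmin⟩ := isCompact_Icc.exists_isMinOn
    (Set.nonempty_Icc.2 (by norm_num : (1/2:ℝ) ≤ 1)) hcont
  have hne1 : ks ≠ 1/2 := by
    rintro rfl
    exact absurd (hmin (Set.Ioo_subset_Icc_self hy1)) (not_le.2 hy1')
  have hne2 : ks ≠ 1 := by
    rintro rfl
    exact absurd (hmin (Set.Ioo_subset_Icc_self hy2)) (not_le.2 hy2V)
  have hlt1 : 1/2 < ks := lt_of_le_of_ne hks.1 hne1.symm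
  have hlt2 : ks < 1 := lt_of_le_of_ne hks.2 hne2
  have hloc : IsLocalMin V ks := hmin.isLocalMin (Icc_mem_nhds hlt1 hlt2)
  have hglob : IsMinOn V (Set.Ioi 0) ks :=
    IsMinOn.of_isLocalMinOn_of_convexOn (hsub hks) (hloc.on _) hconv.convexOn
  refine ⟨ks, ⟨hlt1, hlt2⟩, fun k hk hkne => ?_⟩
  refine lt_of_le_of_ne (hglob hk) fun heq => hkne ?_
  refine hconv.eq_of_isMinOn (fun z hz => ?_) hglob hk (hsub hks)
  have := hglob hz
  simp only [Set.mem_ofPred_eq] at this ⊢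
  linarith


/-- The terminal variance `V(k)` of an exploratory mean-variance investor using the
misspecified Sharpe ratio `kρ̂` (with `a = ‖ρ̂‖²`), extended continuously at `k = 1`,
is strictly convex on `(0,∞)` and its unique minimizer `k*` lies in `(1/2, 1)`. -/
theorem stmt_19 (a T c m : ℝ) (d : ℕ) (ha : 0 < a) (hT : 0 < T) (hc : 0 < c)
    (hd : 1 ≤ d) (hm : 0 < m)
    (V : ℝ → ℝ)
    (hV : ∀ k : ℝ, V k =
      (if k ^ 2 = k then c * d * T / 2
        else c * d * (Real.exp (2 * T * (k ^ 2 - k) * a) - 1) / (4 * (k ^ 2 - k) * a)) +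
      m * (Real.exp (k ^ 2 * a * T) - 1) / (Real.exp (k * a * T) - 1) ^ 2) :
    StrictConvexOn ℝ (Set.Ioi 0) V ∧
    ∃ kstar : ℝ, kstar ∈ Set.Ioo (1 / 2 : ℝ) 1 ∧
      ∀ k : ℝ, 0 < k → k ≠ kstar → V kstar < V k := by
  have hd' : (0:ℝ) < d := by exact_mod_cast hd
  refine main (2*T*a) (a*T) (c*d*T/2) m (by positivity) (by positivity) (by positivity) hm V ?_
  funext k
  rw [hV k]
  congr 1
  · split_ifs with h
    · rw [h]; simp [phi_zero]
    · have h' : k^2 - k ≠ 0 := sub_ne_zero.2 h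
      rw [phi_eq _ (by positivity)]
      have e : 2 * T * (k ^ 2 - k) * a = 2 * T * a * (k ^ 2 - k) := by ring
      rw [e]
      field_simp
      ring
  · simp only [G, mul_div_assoc, mul_assoc]
end
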